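/- The Golden exponential series e_F(x) = ∑_{n=0}^∞ x^n/F_n! converges absolutely for every real x, and for every real constant k and every nonzero real x the function x ↦ e_F(kx) is an eigenfunction of the Golden derivative: (e_F(kφx) − e_F(−kx/φ))/(√5·x) = k·e_F(kx). -/

import Mathlib

noncomputable def φ : ℝ := (1 + Real.sqrt 5) / 2

/-- The Fibonacci factorial `F_n! = F_1 ⋯ F_n`. -/
noncomputable def fibFact (n : ℕ) : ℝ := ∏ i ∈ Finset.range n, (Nat.fib (i + 1) : ℝ)

/-- The Golden exponential `e_F`. -/
noncomputable def eF (x : ℝ) : ℝ := ∑' n : ℕ, x ^ n / fibFact n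

theorem fibFact_succ (n : ℕ) : fibFact (n + 1) = fibFact n * (Nat.fib (n + 1) : ℝ) :=
  Finset.prod_range_succ _ _

theorem fibFact_ne_zero (n : ℕ) : fibFact n ≠ 0 :=
  Finset.prod_ne_zero_iff.mpr fun i _ => Nat.cast_ne_zero.mpr (Nat.fib_pos.mpr i.succ_pos).ne'

theorem summable_pow_div_fibFact (x : ℝ) : Summable fun n : ℕ => x ^ n / fibFact n := by
  refine summable_of_ratio_norm_eventually_le (r := 1 / 2) (by norm_num) ?_
  filter_upwards [Filter.eventually_ge_atTop (max 5 ⌈2 * |x|⌉₊)] with n hn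
  have hfib : 2 * |x| ≤ (Nat.fib (n + 1) : ℝ) := by
    have h₁ : ⌈2 * |x|⌉₊ ≤ Nat.fib (n + 1) :=
      ((le_max_right _ _).trans hn).trans
        (n.le_succ.trans (Nat.le_fib_self (((le_max_left _ _).trans hn).trans n.le_succ)))
    exact (Nat.le_ceil _).trans (by exact_mod_cast h₁)
  have hpos : (0 : ℝ) < Nat.fib (n + 1) := Nat.cast_pos.mpr (Nat.fib_pos.mpr n.succ_pos)
  have hterm : x ^ (n + 1) / fibFact (n + 1) = x / Nat.fib (n + 1) * (x ^ n / fibFact n) := by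
    rw [fibFact_succ, pow_succ, mul_div_mul_comm, mul_comm]
  rw [hterm, norm_mul]
  refine mul_le_mul_of_nonneg_right ?_ (norm_nonneg _)
  rw [norm_div, Real.norm_eq_abs, Real.norm_natCast, div_le_iff₀ hpos]
  linarith

theorem eF_goldenRatio_sub_eF_goldenConj (y : ℝ) :
    eF (y * Real.goldenRatio) - eF (y * Real.goldenConj) = Real.sqrt 5 * y * eF y := by
  have hs₁ := summable_pow_div_fibFact (y * Real.goldenRatio)
  have hs₂ := summable_pow_div_fibFact (y * Real.goldenConj)
  unfold eF
  rw [← hs₁.tsum_sub hs₂, (hs₁.sub hs₂).tsum_eq_zero_add, ← tsum_mul_left]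
  simp only [pow_zero, sub_self, zero_add]
  refine tsum_congr fun n => ?_
  have hfib : Real.goldenRatio ^ (n + 1) - Real.goldenConj ^ (n + 1) =
      Real.sqrt 5 * (Nat.fib (n + 1) : ℝ) := by
    rw [Real.coe_fib_eq, mul_div_cancel₀ _ (by positivity)]
  have hne : (Nat.fib (n + 1) : ℝ) ≠ 0 := Nat.cast_ne_zero.mpr (Nat.fib_pos.mpr n.succ_pos).ne'
  have hfact := fibFact_ne_zero n
  rw [← sub_div, mul_pow, mul_pow, ← mul_sub, hfib, fibFact_succ, pow_succ]
  field_simp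

theorem golden_exponential_eigenfunction :
    (∀ x : ℝ, Summable fun n : ℕ => |x ^ n / fibFact n|) ∧
    (∀ k : ℝ, ∀ x : ℝ, x ≠ 0 →
      (eF (k * (φ * x)) - eF (k * (-x / φ))) / (Real.sqrt 5 * x) = k * eF (k * x)) := by
  refine ⟨fun x => (summable_pow_div_fibFact x).abs, fun k x hx => ?_⟩
  have hφ : φ = Real.goldenRatio := rfl
  have h₁ : k * (φ * x) = k * x * Real.goldenRatio := by rw [hφ]; ring
  have h₂ : k * (-x / φ) = k * x * Real.goldenConj := by
    rw [hφ, div_eq_mul_inv, Real.inv_goldenRatio]; ring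
  rw [h₁, h₂, eF_goldenRatio_sub_eF_goldenConj, div_eq_iff (by positivity)]
  ring
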